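/- arXiv:1612.06751 — 6 statements merged into one kernel-verified Lean document; each statement's English description precedes it below -/
import Mathlib

section
/- Let H be a complex Hilbert space, K a positive self-adjoint contraction on H, and P, Q orthogonal projections on H with Q ∘ P = 0. Assume ‖P ∘ K‖ < 1, and set R := (Q + P) ∘ K ∘ (Q + P). Then ‖P ∘ R‖ < 1, the operators 1 − P ∘ K and 1 − P ∘ R are invertible in the algebra of bounded operators on H, and (1 − P) ∘ R ∘ (1 − P ∘ R)⁻¹ ∘ (1 − P) = Q ∘ ((1 − P) ∘ K ∘ (1 − P ∘ K)⁻¹ ∘ (1 − P)) ∘ Q. -/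
open ContinuousLinearMap

/-- Push-through identity: if `E` fixes `P` on the left, then `E` intertwines the inverses of
`1 - P * K * E` and `1 - P * K`. -/
theorem mul_inverse_one_sub_compression {A : Type*} [Ring A] {E P K : A} (hEP : E * P = P)
    (h₁ : IsUnit (1 - P * K)) (h₂ : IsUnit (1 - P * K * E)) :
    E * Ring.inverse (1 - P * K * E) = Ring.inverse (1 - P * K) * E := by
  have key : E * (1 - P * K * E) = (1 - P * K) * E := by
    rw [mul_sub, sub_mul, mul_one, one_mul, ← mul_assoc, ← mul_assoc, hEP]
  calc E * Ring.inverse (1 - P * K * E)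
      = Ring.inverse (1 - P * K) * ((1 - P * K) * E) * Ring.inverse (1 - P * K * E) := by
        rw [← mul_assoc, Ring.inverse_mul_cancel _ h₁, one_mul]
    _ = Ring.inverse (1 - P * K) * E := by
        rw [← key, mul_assoc, mul_assoc, Ring.mul_inverse_cancel _ h₂, mul_one]

/-- Lemma 3.2 of the paper, abstract form. -/
theorem stmt0 {H : Type*} [NormedAddCommGroup H] [InnerProductSpace ℂ H] [CompleteSpace H]
    (K P Q R : H →L[ℂ] H)
    (hKpos : K.IsPositive) (hKnorm : ‖K‖ ≤ 1)
    (hPsa : IsSelfAdjoint P) (hPidem : P ∘L P = P)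
    (hQsa : IsSelfAdjoint Q) (hQidem : Q ∘L Q = Q)
    (hQP : Q ∘L P = 0)
    (hR : R = (Q + P) ∘L K ∘L (Q + P))
    (hPK : ‖P ∘L K‖ < 1) :
    ‖P ∘L R‖ < 1 ∧
    IsUnit (1 - P ∘L K) ∧ IsUnit (1 - P ∘L R) ∧
    (1 - P) ∘L R ∘L Ring.inverse (1 - P ∘L R) ∘L (1 - P) =
      Q ∘L ((1 - P) ∘L K ∘L Ring.inverse (1 - P ∘L K) ∘L (1 - P)) ∘L Q := by
  simp only [← ContinuousLinearMap.mul_def] at *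
  have hPQ : P * Q = 0 := by
    simpa [hPsa.star_eq, hQsa.star_eq] using congrArg star hQP
  have hEP : (Q + P) * P = P := by rw [add_mul, hQP, hPidem, zero_add]
  have hE : IsStarProjection (Q + P) :=
    ⟨by simp [IsIdempotentElem, mul_add, add_mul, hPQ, hQP, hPidem, hQidem], hQsa.add hPsa⟩
  have hPR : P * R = P * K * (Q + P) := by
    rw [hR, ← mul_assoc, mul_add, hPQ, hPidem, zero_add, ← mul_assoc]
  have hPRnorm : ‖P * R‖ < 1 := by
    rw [hPR]
    exact ((norm_mul_le _ _).trans
      (mul_le_of_le_one_right (norm_nonneg _) hE.norm_le)).trans_lt hPK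
  have h₁ := isUnit_one_sub_of_norm_lt_one hPK
  have h₂ := isUnit_one_sub_of_norm_lt_one hPRnorm
  refine ⟨hPRnorm, h₁, h₂, ?_⟩
  have hleft : (1 - P) * (Q + P) = Q := by
    simp [mul_add, sub_mul, hPQ, hPidem]
  have hright : (Q + P) * (1 - P) = Q := by rw [mul_sub, mul_one, hEP, add_sub_cancel_right]
  have hQl : Q * (1 - P) = Q := by rw [mul_sub, mul_one, hQP, sub_zero]
  have hQr : (1 - P) * Q = Q := by rw [sub_mul, one_mul, hPQ, sub_zero]
  rw [hPR] at h₂ ⊢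
  calc (1 - P) * (R * (Ring.inverse (1 - P * K * (Q + P)) * (1 - P)))
      = ((1 - P) * (Q + P)) * K * ((Q + P) * Ring.inverse (1 - P * K * (Q + P))) * (1 - P) := by
        rw [hR]; simp only [mul_assoc]
    _ = Q * K * Ring.inverse (1 - P * K) * ((Q + P) * (1 - P)) := by
        rw [hleft, mul_inverse_one_sub_compression hEP h₁ h₂]; simp only [mul_assoc]
    _ = (Q * (1 - P)) * K * Ring.inverse (1 - P * K) * ((1 - P) * Q) := by
        rw [hright, hQl, hQr]
    _ = Q * ((1 - P) * (K * (Ring.inverse (1 - P * K) * (1 - P))) * Q) := by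
        simp only [mul_assoc]
end

section
/- Let H be a complex Hilbert space, K a bounded operator on H, and P, Q orthogonal projections on H with Q ∘ P = 0. Set R := (Q + P) ∘ K ∘ (Q + P). Then for every natural number n, (1 − P) ∘ R ∘ (P ∘ R)^n ∘ (1 − P) = Q ∘ (1 − P) ∘ K ∘ (P ∘ K)^n ∘ (1 − P) ∘ Q, where (P ∘ R)^n denotes the n-fold composition of P ∘ R with itself. -/
open ContinuousLinearMap

/-- If `p` is idempotent and `p * q = q * p = 0`, compressing `k` by `q + p` does not change the terms
of the Neumann series, up to cutting off by `q` on both sides. -/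
theorem IsIdempotentElem.one_sub_mul_compress_mul_pow {A : Type*} [Ring A] {k p q : A}
    (hp : IsIdempotentElem p) (hqp : q * p = 0) (hpq : p * q = 0) (n : ℕ) :
    (1 - p) * (((q + p) * (k * (q + p))) *
      ((p * ((q + p) * (k * (q + p)))) ^ n * (1 - p))) =
      q * ((1 - p) * (k * ((p * k) ^ n * ((1 - p) * q)))) := by
  have hp' : p * p = p := hp
  have h_left : (1 - p) * (q + p) = q := by
    simp [sub_mul, mul_add, hpq, hp']
  have h_right : (q + p) * (1 - p) = q := by
    simp [add_mul, mul_sub, hqp, hp']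
  have h_p_left : p * (q + p) = p := by simp [mul_add, hpq, hp']
  have h_p_right : (q + p) * p = p := by simp [add_mul, hqp, hp']
  have h_q_left : q * (1 - p) = q := by simp [mul_sub, hqp]
  have h_q_right : (1 - p) * q = q := by simp [sub_mul, hpq]
  have h_semiconj : SemiconjBy (q + p) (p * (k * (q + p))) (p * k) := by
    rw [SemiconjBy, ← mul_assoc, h_p_right, mul_assoc]
  have h_pow := (h_semiconj.pow_right n).eq
  calc
    _ = (1 - p) * (q + p) * k * ((q + p) * (p * (q + p) * (k * (q + p))) ^ n) * (1 - p) := by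
      simp only [mul_assoc]
    _ = q * k * ((p * k) ^ n * ((q + p) * (1 - p))) := by
      rw [h_left, mul_assoc p, ← mul_assoc p, h_p_left, h_pow]
      simp only [mul_assoc]
    _ = q * (1 - p) * (k * ((p * k) ^ n * ((1 - p) * q))) := by
      rw [h_right, h_q_left, h_q_right, mul_assoc]
    _ = _ := mul_assoc _ _ _

/-- Term-by-term Neumann series identity from Lemma 3.2 of the paper. -/
theorem stmt1 {H : Type*} [NormedAddCommGroup H] [InnerProductSpace ℂ H] [CompleteSpace H]
    (K P Q R : H →L[ℂ] H)
    (hPsa : IsSelfAdjoint P) (hPidem : P ∘L P = P)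
    (hQsa : IsSelfAdjoint Q) (hQidem : Q ∘L Q = Q)
    (hQP : Q ∘L P = 0)
    (hR : R = (Q + P) ∘L K ∘L (Q + P)) :
    ∀ n : ℕ,
      (1 - P) ∘L R ∘L ((P ∘L R) ^ n) ∘L (1 - P) =
        Q ∘L (1 - P) ∘L K ∘L ((P ∘L K) ^ n) ∘L (1 - P) ∘L Q := by
  intro n
  have hPQ : P * Q = 0 := by
    simpa [hPsa.star_eq, hQsa.star_eq] using congrArg star (show Q * P = 0 from hQP)
  rw [hR]
  exact IsIdempotentElem.one_sub_mul_compress_mul_pow (A := H →L[ℂ] H) hPidem hQP hPQ n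
end

section
/- Let β and α be nonempty standard Borel spaces, ρ a probability measure on β × α, and f : α → ℤ a measurable function. Let z ↦ ρ.condKernel z denote a disintegration of ρ with respect to its first coordinate, i.e. a Markov kernel from β to α with ρ = (first marginal of ρ) ⊗ condKernel. Then for ρ-almost every pair (z, y) ∈ β × α, one has (ρ.condKernel z)({x ∈ α : f(x) = f(y)}) > 0. -/
open MeasureTheory

/-- Almost every point lies in a fibre of positive measure of a map with countable codomain. -/
theorem ae_measure_fiber_pos {α ι : Type*} [MeasurableSpace α] [Countable ι]
    (μ : Measure α) (f : α → ι) : ∀ᵐ y ∂μ, 0 < μ {x | f x = f y} := by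
  have h : ∀ n : ι, ∀ᵐ y ∂μ, f y = n → 0 < μ {x | f x = n} := by
    intro n
    by_cases hn : μ {x | f x = n} = 0
    · have hne : ∀ᵐ y ∂μ, ¬ f y = n := by simpa [ae_iff] using hn
      filter_upwards [hne] with y hy hy'
      exact absurd hy' hy
    · exact Filter.Eventually.of_forall fun _ _ => pos_iff_ne_zero.mpr hn
  filter_upwards [ae_all_iff.mpr h] with y hy
  exact hy (f y) rfl

/-- The kernel mass of the fibre of a countably valued map through a point depends measurably on
the parameter and the point. -/
theorem measurable_kernel_fiber {β α ι : Type*} [MeasurableSpace β] [MeasurableSpace α]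
    [MeasurableSpace ι] [Countable ι] [MeasurableSingletonClass ι]
    (κ : ProbabilityTheory.Kernel β α) {f : α → ι} (hf : Measurable f) :
    Measurable fun p : β × α => κ p.1 {x | f x = f p.2} := by
  have h : Measurable fun q : β × ι => κ q.1 {x | f x = q.2} :=
    measurable_from_prod_countable_left fun n =>
      κ.measurable_coe (hf (measurableSet_singleton n))
  exact h.comp (measurable_fst.prodMk (hf.comp measurable_snd))

/-- Lemma 6.2 of the paper: conditionally on the first coordinate, the value of an
integer-valued function of the second coordinate is attained with positive probability. -/
theorem stmt9 {β α : Type*}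
    [MeasurableSpace β] [StandardBorelSpace β] [Nonempty β]
    [MeasurableSpace α] [StandardBorelSpace α] [Nonempty α]
    (ρ : Measure (β × α)) [IsProbabilityMeasure ρ]
    (f : α → ℤ) (hf : Measurable f) :
    ∀ᵐ p ∂ρ, 0 < ρ.condKernel p.1 {x | f x = f p.2} := by
  have h : ∀ᵐ p ∂(ρ.fst.compProd ρ.condKernel), 0 < ρ.condKernel p.1 {x | f x = f p.2} :=
    Measure.ae_compProd_of_ae_ae
      (measurableSet_lt measurable_const (measurable_kernel_fiber ρ.condKernel hf))
      (Filter.Eventually.of_forall fun z => ae_measure_fiber_pos (ρ.condKernel z) f)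
  rwa [ρ.disintegrate ρ.condKernel] at h
end

section
/- Let α, β, γ be nonempty standard Borel spaces and μ a probability measure on α × (β × γ). Let κ := μ.condKernel (a Markov kernel from α to β × γ), let μ' be the pushforward of μ under the associativity map (a, (b, c)) ↦ ((a, b), c) and κ' := μ'.condKernel (a Markov kernel from α × β to γ), and let ν be the pushforward of μ under (a, (b, c)) ↦ (a, b) with λ := ν.condKernel (a Markov kernel from α to β). Then for (first marginal of μ)-almost every a ∈ α, the pushforward under Prod.snd of κ a (a probability measure on γ) equals the measure (λ a).bind (fun b ↦ κ' (a, b)), i.e. the average of the measures κ' (a, b) over b with respect to λ a. -/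
open MeasureTheory
open ProbabilityTheory

/-- Lemma 8.3 of the paper (measure-theoretic form): the marginal on `γ` of the
conditional given `α` is the average over `β` of the conditional given `α × β`. -/
theorem stmt11 {α β γ : Type*}
    [MeasurableSpace α] [StandardBorelSpace α] [Nonempty α]
    [MeasurableSpace β] [StandardBorelSpace β] [Nonempty β]
    [MeasurableSpace γ] [StandardBorelSpace γ] [Nonempty γ]
    (μ : Measure (α × (β × γ))) [IsProbabilityMeasure μ]
    (μ' : Measure ((α × β) × γ)) [IsFiniteMeasure μ']
    (hμ' : μ' = μ.map (fun p => ((p.1, p.2.1), p.2.2)))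
    (ν : Measure (α × β)) [IsFiniteMeasure ν]
    (hν : ν = μ.map (fun p => (p.1, p.2.1))) :
    ∀ᵐ a ∂μ.fst,
      (μ.condKernel a).map Prod.snd =
        (ν.condKernel a).bind (fun b => μ'.condKernel (a, b)) := by
  have hfst' : μ'.fst = ν := by
    rw [hμ', hν, Measure.fst, Measure.map_map measurable_fst (by fun_prop)]
    rfl
  have hfst : ν.fst = μ.fst := by
    rw [hν, Measure.fst, Measure.fst, Measure.map_map measurable_fst (by fun_prop)]
    rfl
  have hdis' : ν ⊗ₘ μ'.condKernel = μ' := by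
    rw [← hfst', μ'.disintegrate]
  have hdis : μ = μ.fst ⊗ₘ (ν.condKernel ⊗ₖ μ'.condKernel) := by
    rw [← hfst, ← Measure.compProd_assoc', ν.disintegrate, hdis', hμ',
      Measure.map_map (by fun_prop) (by fun_prop)]
    exact Measure.map_id.symm
  filter_upwards [eq_condKernel_of_measure_eq_compProd _ hdis] with a ha
  rw [← ha]
  ext s hs
  have hmeas : Measurable fun b => μ'.condKernel (a, b) :=
    μ'.condKernel.measurable.comp measurable_prodMk_left
  rw [Measure.map_apply measurable_snd hs, Kernel.compProd_apply (measurable_snd hs),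
    Measure.bind_apply hs hmeas.aemeasurable]
  rfl
end

section
/- Let Ω be a nonempty standard Borel space equipped with a probability measure P, let (mₙ)ₙ∈ℕ be a monotone increasing sequence of sub-σ-algebras of the Borel σ-algebra of Ω, and let m∞ := ⨆ₙ mₙ. Let S be a Polish space with its Borel σ-algebra and Z : Ω → S a Borel measurable map. Then there exist maps μₙ : Ω → (probability measures on S), for n ∈ ℕ ∪ {∞}, such that: (i) for every n and every Borel set A ⊆ S, the function ω ↦ μₙ(ω)(A) is mₙ-measurable and is a version of the conditional expectation E[1_{Z ∈ A} | mₙ] (for n = ∞, with respect to m∞); and (ii) for P-almost every ω, the sequence μₙ(ω) converges to μ∞(ω) in the topology of weak convergence of probability measures on S. -/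
open MeasureTheory Filter Topology

open ProbabilityTheory Set

/-- A second countable space has a countable topological basis which is a π-system. -/
theorem exists_countable_isPiSystem_isTopologicalBasis (S : Type*) [TopologicalSpace S]
    [SecondCountableTopology S] :
    ∃ C : Set (Set S), C.Countable ∧ IsPiSystem C ∧ TopologicalSpace.IsTopologicalBasis C := by
  refine ⟨_, (Set.countable_ofPred_finite_subset
    (TopologicalSpace.countable_countableBasis S)).image _, ?_,
    TopologicalSpace.isTopologicalBasis_of_subbasis
      (TopologicalSpace.eq_generateFrom_countableBasis S)⟩
  rintro _ ⟨s, ⟨hs, hsC⟩, rfl⟩ _ ⟨t, ⟨ht, htC⟩, rfl⟩ -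
  exact ⟨s ∪ t, ⟨hs.union ht, union_subset hsC htC⟩, sInter_union s t⟩

/-- Convergence of the masses of all members of a basis which is a π-system implies weak
convergence of probability measures. -/
theorem tendsto_integral_of_isPiSystem_isTopologicalBasis {S : Type*} [TopologicalSpace S]
    [SecondCountableTopology S] [HasOuterApproxClosed S] [MeasurableSpace S] [BorelSpace S]
    {C : Set (Set S)} (hpi : IsPiSystem C) (hbasis : TopologicalSpace.IsTopologicalBasis C)
    {μ : ℕ → Measure S} {ν : Measure S} (hμ : ∀ n, IsProbabilityMeasure (μ n))
    (hν : IsProbabilityMeasure ν)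
    (hlim : ∀ A ∈ C, Tendsto (fun n => (μ n A).toReal) atTop (𝓝 (ν A).toReal))
    (g : BoundedContinuousFunction S ℝ) :
    Tendsto (fun n => ∫ x, g x ∂(μ n)) atTop (𝓝 (∫ x, g x ∂ν)) := by
  let μ' (n : ℕ) : ProbabilityMeasure S := ⟨μ n, hμ n⟩
  let ν' : ProbabilityMeasure S := ⟨ν, hν⟩
  have hweak : Tendsto μ' atTop (𝓝 ν') := by
    refine hpi.tendsto_probabilityMeasure_of_tendsto_of_mem
      (fun A hA => (hbasis.isOpen hA).measurableSet) (fun u hu x hx => ?_)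
      fun A hA => NNReal.tendsto_coe.1 (hlim A hA)
    obtain ⟨A, hA, hxA, hAu⟩ := hbasis.exists_subset_of_mem_open hx hu
    exact ⟨A, hA, (hbasis.isOpen hA).mem_nhds hxA, hAu⟩
  exact ProbabilityMeasure.tendsto_iff_forall_integral_tendsto.1 hweak g

section RegularConditionalDistribution

variable {Ω : Type*} {m : MeasurableSpace Ω} [mΩ : MeasurableSpace Ω] [StandardBorelSpace Ω]
  {P : Measure Ω} [IsProbabilityMeasure P] {S : Type*} [MeasurableSpace S] {Z : Ω → S}

theorem isProbabilityMeasure_map_condExpKernel (hZ : Measurable Z) (ω : Ω) :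
    IsProbabilityMeasure ((condExpKernel P m ω).map Z) :=
  Measure.isProbabilityMeasure_map hZ.aemeasurable

theorem measurable_map_condExpKernel_apply (hZ : Measurable Z) {A : Set S}
    (hA : MeasurableSet A) : Measurable[m] fun ω => (condExpKernel P m ω).map Z A := by
  simp_rw [Measure.map_apply hZ hA]
  exact measurable_condExpKernel (hZ hA)

theorem toReal_map_condExpKernel_ae_eq_condExp (hm : m ≤ mΩ)
    (hZ : Measurable Z) {A : Set S} (hA : MeasurableSet A) :
    (fun ω => ((condExpKernel P m ω).map Z A).toReal) =ᵐ[P]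
      P[(Z ⁻¹' A).indicator (fun _ => (1 : ℝ)) | m] := by
  simp_rw [Measure.map_apply hZ hA]
  exact condExpKernel_ae_eq_condExp hm (hZ hA)

/-- Lévy's upward theorem for the regular conditional probabilities of a fixed event. -/
theorem ae_tendsto_toReal_map_condExpKernel {m : ℕ → MeasurableSpace Ω} (hmono : Monotone m)
    (hle : ∀ n, m n ≤ mΩ) (hZ : Measurable Z) {A : Set S} (hA : MeasurableSet A) :
    ∀ᵐ ω ∂P, Tendsto (fun n => ((condExpKernel P (m n) ω).map Z A).toReal) atTop
      (𝓝 ((condExpKernel P (⨆ n, m n) ω).map Z A).toReal) := by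
  filter_upwards [ae_all_iff.2 fun n =>
      toReal_map_condExpKernel_ae_eq_condExp (P := P) (hle n) hZ hA,
    toReal_map_condExpKernel_ae_eq_condExp (P := P) (iSup_le hle) hZ hA,
    tendsto_ae_condExp (μ := P) (ℱ := ⟨m, hmono, hle⟩)
      ((Z ⁻¹' A).indicator fun _ => (1 : ℝ))] with ω hn hinf hlim
  rw [hinf]
  exact hlim.congr fun n => (hn n).symm

end RegularConditionalDistribution

/-- Proposition 8.2 of the paper: regular conditional distributions along an increasing
sequence of sub-σ-algebras form a measure-valued martingale converging almost surely
in the topology of weak convergence. -/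
theorem stmt12 {Ω : Type*} [mΩ : MeasurableSpace Ω] [StandardBorelSpace Ω] [Nonempty Ω]
    (P : Measure Ω) [IsProbabilityMeasure P]
    (m : ℕ → MeasurableSpace Ω) (hmono : Monotone m) (hle : ∀ n, m n ≤ mΩ)
    {S : Type*} [TopologicalSpace S] [PolishSpace S] [MeasurableSpace S] [BorelSpace S]
    [Nonempty S]
    (Z : Ω → S) (hZ : Measurable Z) :
    ∃ (μ : ℕ → Ω → Measure S) (μinf : Ω → Measure S),
      (∀ n ω, IsProbabilityMeasure (μ n ω)) ∧
      (∀ ω, IsProbabilityMeasure (μinf ω)) ∧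
      (∀ n, ∀ A : Set S, MeasurableSet A →
        Measurable[m n] (fun ω => μ n ω A) ∧
        (fun ω => (μ n ω A).toReal) =ᵐ[P]
          P[(Z ⁻¹' A).indicator (fun _ => (1 : ℝ)) | m n]) ∧
      (∀ A : Set S, MeasurableSet A →
        Measurable[⨆ n, m n] (fun ω => μinf ω A) ∧
        (fun ω => (μinf ω A).toReal) =ᵐ[P]
          P[(Z ⁻¹' A).indicator (fun _ => (1 : ℝ)) | ⨆ n, m n]) ∧
      (∀ᵐ ω ∂P, ∀ g : BoundedContinuousFunction S ℝ,
        Tendsto (fun n => ∫ x, g x ∂(μ n ω)) atTop (𝓝 (∫ x, g x ∂(μinf ω)))) := by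
  refine ⟨fun n ω => (condExpKernel P (m n) ω).map Z,
    fun ω => (condExpKernel P (⨆ n, m n) ω).map Z,
    fun n => isProbabilityMeasure_map_condExpKernel hZ,
    isProbabilityMeasure_map_condExpKernel hZ,
    fun n A hA => ⟨measurable_map_condExpKernel_apply hZ hA,
      toReal_map_condExpKernel_ae_eq_condExp (hle n) hZ hA⟩,
    fun A hA => ⟨measurable_map_condExpKernel_apply hZ hA,
      toReal_map_condExpKernel_ae_eq_condExp (iSup_le hle) hZ hA⟩, ?_⟩
  obtain ⟨C, hC, hpi, hbasis⟩ := exists_countable_isPiSystem_isTopologicalBasis S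
  filter_upwards [(ae_ball_iff hC).2 fun A hA =>
    ae_tendsto_toReal_map_condExpKernel (P := P) hmono hle hZ
      (hbasis.isOpen hA).measurableSet] with ω hω
  exact tendsto_integral_of_isPiSystem_isTopologicalBasis hpi hbasis
    (fun n => isProbabilityMeasure_map_condExpKernel hZ ω)
    (isProbabilityMeasure_map_condExpKernel hZ ω) hω
end

section
/- Let (Ω, ℱ, P) be a probability space. Let (𝒜ₗ)ₗ∈ℕ be a monotone increasing sequence of sub-σ-algebras of ℱ with σ(⋃ₗ 𝒜ₗ) = ℱ, and let (𝒢ₙ)ₙ∈ℕ be a monotone decreasing sequence of sub-σ-algebras of ℱ. Assume that for every ℓ ∈ ℕ and every A₁ ∈ 𝒜ₗ, the expectations E|E[1_{A₁} | 𝒢ₙ] − P(A₁)| tend to 0 as n → ∞. Then the σ-algebra 𝒯 := ⋂ₙ 𝒢ₙ is P-trivial: every A ∈ 𝒯 satisfies P(A) = 0 or P(A) = 1. -/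
open MeasureTheory Filter Topology

/-- The defect of independence of `s` from an event `t` of `m` is bounded by the `L¹` distance
between the conditional probability of `s` given `m` and the probability of `s`. -/
lemma abs_measureReal_inter_sub_mul_le_integral_condExp {Ω : Type*} {m mΩ : MeasurableSpace Ω}
    {P : Measure Ω} [IsFiniteMeasure P] (hm : m ≤ mΩ) {s t : Set Ω}
    (hs : MeasurableSet s) (ht : MeasurableSet[m] t) (c : ℝ) :
    |P.real (s ∩ t) - c * P.real t| ≤
      ∫ ω, |(P[s.indicator (fun _ => (1 : ℝ)) | m]) ω - c| ∂P := by
  have hint : Integrable (fun ω => (P[s.indicator (fun _ => (1 : ℝ)) | m]) ω - c) P :=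
    integrable_condExp.sub (integrable_const _)
  have heq : ∫ ω in t, ((P[s.indicator (fun _ => (1 : ℝ)) | m]) ω - c) ∂P =
      P.real (s ∩ t) - c * P.real t := by
    rw [integral_sub integrable_condExp.integrableOn (integrable_const _),
      setIntegral_condExp hm ((integrable_const _).indicator hs) ht, integral_indicator hs,
      Measure.restrict_restrict hs]
    simp [mul_comm]
  rw [← heq]
  exact abs_integral_le_integral_abs.trans
    (setIntegral_le_integral hint.abs (ae_of_all _ fun _ => abs_nonneg _))

/-- Abstract form of Theorem 1.5 of the paper: the L¹ decay of conditional expectations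
of events from a generating increasing family implies triviality of the tail σ-algebra. -/
theorem stmt13 {Ω : Type*} [mΩ : MeasurableSpace Ω]
    (P : Measure Ω) [IsProbabilityMeasure P]
    (𝒜 : ℕ → MeasurableSpace Ω) (h𝒜mono : Monotone 𝒜) (h𝒜le : ∀ l, 𝒜 l ≤ mΩ)
    (h𝒜gen : (⨆ l, 𝒜 l) = mΩ)
    (𝒢 : ℕ → MeasurableSpace Ω) (h𝒢anti : Antitone 𝒢) (h𝒢le : ∀ n, 𝒢 n ≤ mΩ)
    (hdecay : ∀ l : ℕ, ∀ A₁ : Set Ω, MeasurableSet[𝒜 l] A₁ →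
      Tendsto (fun n =>
          ∫ ω, |(P[A₁.indicator (fun _ => (1 : ℝ)) | 𝒢 n]) ω - (P A₁).toReal| ∂P)
        atTop (𝓝 0)) :
    ∀ A : Set Ω, MeasurableSet[⨅ n, 𝒢 n] A → P A = 0 ∨ P A = 1 := by
  have h𝒯le : (⨅ n, 𝒢 n) ≤ mΩ := (iInf_le 𝒢 0).trans (h𝒢le 0)
  have hindep (l : ℕ) : ProbabilityTheory.Indep (𝒜 l) (⨅ n, 𝒢 n) P := by
    rw [ProbabilityTheory.Indep_iff]
    intro s t hs ht
    have hle : |P.real (s ∩ t) - P.real s * P.real t| ≤ 0 :=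
      ge_of_tendsto' (hdecay l s hs) fun n =>
        abs_measureReal_inter_sub_mul_le_integral_condExp (h𝒢le n) (h𝒜le l s hs)
          (iInf_le 𝒢 n t ht) (P.real s)
    rw [← ENNReal.toReal_eq_toReal_iff' (measure_ne_top _ _) (by finiteness), ENNReal.toReal_mul]
    exact sub_eq_zero.1 (abs_nonpos_iff.1 hle)
  have h := ProbabilityTheory.indep_iSup_of_monotone hindep h𝒜le h𝒯le h𝒜mono
  rw [h𝒜gen] at h
  intro A hA
  exact ProbabilityTheory.measure_eq_zero_or_one_of_indepSet_self
    (h.indepSet_of_measurableSet (h𝒯le A hA) hA)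
end
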